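/- For the pair (F_i, G_i) with i ≥ 2, one step of the mixed-equivalence regularizing algorithm yields (k,l) = (1,1) and residual (F_{i−1}, G_{i−1}); for i = 1 (where F₁ = G₁ is the 1×0 empty matrix) it yields (k,l) = (1,0) and the 0×0 residual pair. -/

import Mathlib

open Matrix

def MixedEquiv {m n : Type*} [Fintype m] [DecidableEq m] [Fintype n] [DecidableEq n]
    (A B A' B' : Matrix m n ℂ) : Prop :=
  ∃ (S : Matrix m m ℂ) (R : Matrix n n ℂ), IsUnit S ∧ IsUnit R ∧
    S * A * R = A' ∧ S * B * R.map (starRingEnd ℂ) = B'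

/-- `(A,B)` reduces in one step of the regularizing algorithm to the residual pair
`(A₁, B₁)`, with zero block of size `K × L`. -/
def Reduces {K M L N : Type*} [Fintype K] [DecidableEq K] [Fintype M] [DecidableEq M]
    [Fintype L] [DecidableEq L] [Fintype N] [DecidableEq N]
    (A B : Matrix (K ⊕ M) (L ⊕ N) ℂ) (A₁ B₁ : Matrix M N ℂ) : Prop :=
  ∃ (X : Matrix M L ℂ) (B' : Matrix K L ℂ) (Y : Matrix M L ℂ),
    LinearIndependent ℂ (fun i : M => Sum.elim (X i) (A₁ i)) ∧
    (LinearIndependent ℂ fun j : L => fun i => B' i j) ∧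
    MixedEquiv A B (fromBlocks 0 0 X A₁) (fromBlocks B' 0 Y B₁)

/-- The `k×k` singular Jordan block (ones on the subdiagonal). -/
noncomputable def Jmat (k : ℕ) : Matrix (Fin k) (Fin k) ℂ :=
  Matrix.of fun i j => if (i : ℕ) = (j : ℕ) + 1 then 1 else 0

/-- `F_n` : the `n × (n-1)` matrix with ones on the subdiagonal. -/
noncomputable def Fmat (n : ℕ) : Matrix (Fin n) (Fin (n - 1)) ℂ :=
  Matrix.of fun i j => if (i : ℕ) = (j : ℕ) + 1 then 1 else 0

/-- `G_n` : the `n × (n-1)` matrix with ones on the diagonal. -/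
noncomputable def Gmat (n : ℕ) : Matrix (Fin n) (Fin (n - 1)) ℂ :=
  Matrix.of fun i j => if (i : ℕ) = (j : ℕ) then 1 else 0

theorem MixedEquiv.of_eq {m n : Type*} [Fintype m] [DecidableEq m] [Fintype n] [DecidableEq n]
    {A B A' B' : Matrix m n ℂ} (hA : A = A') (hB : B = B') : MixedEquiv A B A' B' :=
  ⟨1, 1, isUnit_one, isUnit_one, by simpa using hA, by
    simpa [Matrix.map_one _ (map_zero _) (map_one _)] using hB⟩

/-- The rows of the matrix obtained by putting the first unit column to the left of `F_n` are the
unit vectors, hence independent. -/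
theorem linearIndependent_unit_column_Fmat (n : ℕ) :
    LinearIndependent ℂ fun i : Fin n =>
      Sum.elim (fun _ : Fin 1 => if (i : ℕ) = 0 then (1 : ℂ) else 0) (Fmat n i) := by
  rw [Fintype.linearIndependent_iff]
  intro g hg i
  by_cases hi : (i : ℕ) = 0
  · have h := congrFun hg (Sum.inl 0)
    have hji : ∀ j : Fin n, (j : ℕ) = 0 ↔ j = i := fun j => by rw [Fin.ext_iff, hi]
    simpa [Finset.sum_apply, hji] using h
  · have h := congrFun hg (Sum.inr ⟨i - 1, by omega⟩)
    have hji : ∀ j : Fin n, (j : ℕ) = (i : ℕ) - 1 + 1 ↔ j = i := fun j => by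
      rw [Fin.ext_iff]; omega
    simpa [Finset.sum_apply, Fmat, hji] using h

/-- One step of the regularizing algorithm on `(F_i, G_i)`: for `i ≥ 2` the zero block has
size `(k,l) = (1,1)` and the residual pair is `(F_{i-1}, G_{i-1})`; for `i = 1` the zero
block has size `(1,0)` and the residual pair is empty. -/
theorem FG_pair_one_step :
    (∀ (i : ℕ) (hi : 2 ≤ i),
      Reduces
        ((Fmat i).reindex ((finCongr (by omega : i = 1 + (i - 1))).trans finSumFinEquiv.symm)
          ((finCongr (by omega : i - 1 = 1 + (i - 1 - 1))).trans finSumFinEquiv.symm))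
        ((Gmat i).reindex ((finCongr (by omega : i = 1 + (i - 1))).trans finSumFinEquiv.symm)
          ((finCongr (by omega : i - 1 = 1 + (i - 1 - 1))).trans finSumFinEquiv.symm))
        (Fmat (i - 1)) (Gmat (i - 1))) ∧
    Reduces
      ((Fmat 1).reindex (finSumFinEquiv (m := 1) (n := 0)).symm
        (finSumFinEquiv (m := 0) (n := 0)).symm)
      ((Gmat 1).reindex (finSumFinEquiv (m := 1) (n := 0)).symm
        (finSumFinEquiv (m := 0) (n := 0)).symm)
      (0 : Matrix (Fin 0) (Fin 0) ℂ) (0 : Matrix (Fin 0) (Fin 0) ℂ) := by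
  refine ⟨fun i hi => ?_, ?_⟩
  · refine ⟨Matrix.of fun r _ => if (r : ℕ) = 0 then 1 else 0, Matrix.of fun _ _ => 1, 0,
      linearIndependent_unit_column_Fmat (i - 1), ?_, ?_⟩
    · rw [Fintype.linearIndependent_iff]
      intro g hg j
      simpa [Finset.sum_apply, Subsingleton.elim j 0] using congrFun hg j
    · refine MixedEquiv.of_eq ?_ ?_
      · ext (r | r) (c | c) <;> simp [Fmat, add_comm 1]
      · ext (r | r) (c | c) <;> simp [Gmat, add_comm 1]
  · refine ⟨0, 0, 0, linearIndependent_empty_type, linearIndependent_empty_type, ?_⟩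
    exact MixedEquiv.of_eq (Subsingleton.elim _ _) (Subsingleton.elim _ _)
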